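/- With L = L(μ, λ) and (ℐ_x)_{x∈L} as defined in the context, the pair (L, (ℐ_x)_{x∈L}) is a template: the relation defined on L is a linear order; each ℐ_x is a family of subsets of L_x containing ∅ and all singletons of elements of L_x and closed under finite unions and finite intersections; ℐ_x ⊆ ℐ_y whenever x < y; and ℐ := ⋃_{x∈L} ℐ_x ∪ {L} is well-founded with respect to strict inclusion. -/

import Mathlib

noncomputable section

namespace Stmt15

/-- Ordinals below `ω₁`, the index set of the partition of `λ*`. -/
abbrev W : Type (u + 1) := {o : Ordinal.{u} // o < (Cardinal.aleph 1 : Cardinal.{u}).ord}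

variable (mu lam : Cardinal.{u})

/-- Elements of `μ` (the possible first entries of members of `L(μ,λ)`). -/
abbrev M : Type (u + 1) := {o : Ordinal.{u} // o < mu.ord}

/-- Elements of `λ`. -/
abbrev Lam : Type (u + 1) := {o : Ordinal.{u} // o < lam.ord}

/-- The linear order `λ* ∪ λ`: a reversed copy of `λ` lying entirely below a copy of `λ`. -/
abbrev V : Type (u + 1) := Lex ((Lam lam)ᵒᵈ ⊕ (Lam lam))

/-- The positive element (member of `λ`) corresponding to `γ`. -/
def posEl (γ : Lam lam) : V lam := toLex (Sum.inr γ)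

/-- The negative element `γ* ∈ λ*` corresponding to `γ`. -/
def negEl (γ : Lam lam) : V lam := toLex (Sum.inl (OrderDual.toDual γ))

/-- `v` is positive, i.e. `v ∈ λ`. -/
def pos (v : V lam) : Prop := ∃ γ : Lam lam, v = posEl lam γ

/-- `v` is negative, i.e. `v ∈ λ*`. -/
def neg (v : V lam) : Prop := ∃ γ : Lam lam, v = negEl lam γ

/-- The tails (entries from position `1` on) of elements of `L(μ,λ)` are finite sequences
with values in `λ* ∪ λ`; this is the comparison of tails sharing the same first entry:
if one is a proper initial segment of the other, the decision is made by the sign of the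
first extra entry, otherwise by the first difference. -/
def ltL : List (V lam) → List (V lam) → Prop
  | [], [] => False
  | [], b :: _ => pos lam b
  | a :: _, [] => neg lam a
  | a :: s, b :: t => (a = b ∧ ltL s t) ∨ (a ≠ b ∧ a < b)

/-- The linear order `L(μ,λ)`: nonempty finite sequences `x` with `x(0) ∈ μ` and
`x(n) ∈ λ* ∪ λ` for `n ≥ 1`, coded as pairs (first entry, list of later entries). -/
abbrev L : Type (u + 1) := M mu × List (V lam)

/-- The order of `L(μ,λ)`. -/
def ltP (x y : L mu lam) : Prop := x.1 < y.1 ∨ (x.1 = y.1 ∧ ltL lam x.2 y.2)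

/-- The corresponding non-strict order. -/
def leP (x y : L mu lam) : Prop := ltP mu lam x y ∨ x = y

/-- `x ∈ L(μ,λ)` is relevant. -/
def Relevant (S : W.{u} → Set (Lam lam)) (x : L mu lam) : Prop :=
  2 ≤ x.2.length ∧ Even x.2.length ∧
  (∀ i : ℕ, i < x.2.length →
    (Odd (i + 1) → ∃ δ : Lam lam, x.2[i]? = some (negEl lam δ)) ∧
    (Even (i + 1) → ∃ γ : Lam lam, x.2[i]? = some (posEl lam γ))) ∧
  (∃ γ : Lam lam, γ.1 < (Cardinal.aleph 1 : Cardinal.{u}).ord ∧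
    x.2[x.2.length - 1]? = some (posEl lam γ)) ∧
  (∀ n m : ℕ, 0 < n → n < m → m ≤ x.2.length → Even n → Even m →
    ∀ γ γ' : Lam lam, x.2[n - 1]? = some (posEl lam γ) → x.2[m - 1]? = some (posEl lam γ') →
      γ.1 < (Cardinal.aleph 1 : Cardinal.{u}).ord → γ'.1 < (Cardinal.aleph 1 : Cardinal.{u}).ord →
      ∃ α β : W.{u}, β < α ∧
        (∃ δ : Lam lam, x.2[n - 2]? = some (negEl lam δ) ∧ δ ∈ S α) ∧
        (∃ δ' : Lam lam, x.2[m - 2]? = some (negEl lam δ') ∧ δ' ∈ S β))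

/-- `J_x`, the interval of points between `x↾(|x|-1)` and `x`. -/
def Jset (x : L mu lam) : Set (L mu lam) :=
  {y | leP mu lam (x.1, x.2.dropLast) y ∧ ltP mu lam y x}

/-- The basic sets generating `ℐ_x`: initial segments `L_α` for `α ∈ μ` with `α ≤ x`,
the intervals `J_y` for relevant `y ≤ x`, the empty set, and singletons `{z}` for `z < x`. -/
def IsBasic (S : W.{u} → Set (Lam lam)) (x : L mu lam) (B : Set (L mu lam)) : Prop :=
  (∃ a : M mu, leP mu lam (a, ([] : List (V lam))) x ∧
      B = {y | ltP mu lam y (a, ([] : List (V lam)))}) ∨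
  (∃ y : L mu lam, Relevant mu lam S y ∧ leP mu lam y x ∧ B = Jset mu lam y) ∨
  B = ∅ ∨
  (∃ z : L mu lam, ltP mu lam z x ∧ B = {z})

/-- `ℐ_x`: the collection of all finite unions of basic sets. -/
def Ix (S : W.{u} → Set (Lam lam)) (x : L mu lam) : Set (Set (L mu lam)) :=
  {B | ∃ s : Finset (Set (L mu lam)), (∀ C ∈ s, IsBasic mu lam S x C) ∧
    B = ⋃₀ (s : Set (Set (L mu lam)))}


section helpers

variable {mu lam}

theorem posEl_lt {a b : Lam lam} : posEl lam a < posEl lam b ↔ a < b := by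
  simp only [posEl]; exact Sum.Lex.inr_lt_inr_iff

theorem posEl_inj {a b : Lam lam} : posEl lam a = posEl lam b ↔ a = b := by
  simp [posEl]

theorem negEl_inj {a b : Lam lam} : negEl lam a = negEl lam b ↔ a = b := by
  simp [negEl]

theorem neg_lt_pos (a b : Lam lam) : negEl lam a < posEl lam b := by
  simp only [negEl, posEl]; exact Sum.Lex.inl_lt_inr _ _

theorem neg_or_pos (v : V lam) : neg lam v ∨ pos lam v := by
  rcases h : ofLex v with a | a
  · left; exact ⟨OrderDual.ofDual a, h⟩
  · right; exact ⟨a, h⟩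

theorem neg_lt_pos' {a b : V lam} (ha : neg lam a) (hb : pos lam b) : a < b := by
  obtain ⟨a, rfl⟩ := ha
  obtain ⟨b, rfl⟩ := hb
  exact neg_lt_pos a b

theorem not_neg_pos {a : V lam} (ha : neg lam a) (hb : pos lam a) : False :=
  lt_irrefl _ (neg_lt_pos' ha hb)

theorem pos_of_lt {a b : V lam} (ha : pos lam a) (h : a < b) : pos lam b := by
  rcases neg_or_pos b with hb | hb
  · exact absurd (h.trans (neg_lt_pos' hb ha)) (lt_irrefl _)
  · exact hb

theorem neg_of_lt {a b : V lam} (hb : neg lam b) (h : a < b) : neg lam a := by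
  rcases neg_or_pos a with ha | ha
  · exact ha
  · exact absurd (h.trans (neg_lt_pos' hb ha)) (lt_irrefl _)

theorem ltL_irrefl : ∀ s : List (V lam), ¬ ltL lam s s
  | [] => by simp [ltL]
  | a :: s => by
      have := ltL_irrefl s
      simp [ltL, this]

theorem ltL_trans : ∀ s t r : List (V lam), ltL lam s t → ltL lam t r → ltL lam s r
  | [], [], _ => by simp [ltL]
  | _, [], [] => by simp [ltL]
  | [], b :: t, [] => by
      simp only [ltL]; exact fun h h' => not_neg_pos h' h
  | [], b :: t, c :: r => by
      simp only [ltL]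
      rintro h (⟨rfl, _⟩ | ⟨_, h'⟩)
      · exact h
      · exact pos_of_lt h h'
  | a :: s, [], c :: r => by
      simp only [ltL]
      intro h h'
      have := neg_lt_pos' h h'
      exact Or.inr ⟨this.ne, this⟩
  | a :: s, b :: t, [] => by
      simp only [ltL]
      rintro (⟨rfl, _⟩ | ⟨_, h'⟩) h
      · exact h
      · exact neg_of_lt h h'
  | a :: s, b :: t, c :: r => by
      have ih := ltL_trans s t r
      simp only [ltL]
      rintro (⟨rfl, h⟩ | ⟨_, h⟩) (⟨rfl, h'⟩ | ⟨_, h'⟩)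
      · exact Or.inl ⟨rfl, ih h h'⟩
      · exact Or.inr ⟨h'.ne, h'⟩
      · exact Or.inr ⟨h.ne, h⟩
      · exact Or.inr ⟨(h.trans h').ne, h.trans h'⟩

theorem ltL_tri : ∀ s t : List (V lam), ltL lam s t ∨ s = t ∨ ltL lam t s
  | [], [] => by simp
  | [], b :: t => by
      simp only [ltL]
      rcases neg_or_pos b with h | h <;> simp [h]
  | b :: t, [] => by
      simp only [ltL]
      rcases neg_or_pos b with h | h <;> simp [h]
  | a :: s, b :: t => by
      simp only [ltL]
      rcases lt_trichotomy a b with h | h | h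
      · exact Or.inl (Or.inr ⟨h.ne, h⟩)
      · subst h
        rcases ltL_tri s t with h | h | h
        · exact Or.inl (Or.inl ⟨rfl, h⟩)
        · subst h; exact Or.inr (Or.inl rfl)
        · exact Or.inr (Or.inr (Or.inl ⟨rfl, h⟩))
      · exact Or.inr (Or.inr (Or.inr ⟨h.ne, h⟩))

theorem ltP_irrefl (x : L mu lam) : ¬ ltP mu lam x x := by
  simp [ltP, ltL_irrefl]

theorem ltP_trans {x y z : L mu lam} (h : ltP mu lam x y) (h' : ltP mu lam y z) :
    ltP mu lam x z := by
  rcases h with h | ⟨h, k⟩ <;> rcases h' with h' | ⟨h', k'⟩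
  · exact Or.inl (h.trans h')
  · exact Or.inl (h' ▸ h)
  · exact Or.inl (h ▸ h')
  · exact Or.inr ⟨h.trans h', ltL_trans _ _ _ k k'⟩

theorem ltP_tri (x y : L mu lam) : ltP mu lam x y ∨ x = y ∨ ltP mu lam y x := by
  rcases lt_trichotomy x.1 y.1 with h | h | h
  · exact Or.inl (Or.inl h)
  · rcases ltL_tri x.2 y.2 with k | k | k
    · exact Or.inl (Or.inr ⟨h, k⟩)
    · exact Or.inr (Or.inl (Prod.ext h k))
    · exact Or.inr (Or.inr (Or.inr ⟨h.symm, k⟩))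
  · exact Or.inr (Or.inr (Or.inl h))

theorem ltP_of_lt_le {x y z : L mu lam} (h : ltP mu lam x y) (h' : leP mu lam y z) :
    ltP mu lam x z := by
  rcases h' with h' | rfl
  · exact ltP_trans h h'
  · exact h

theorem leP_trans {x y z : L mu lam} (h : leP mu lam x y) (h' : leP mu lam y z) :
    leP mu lam x z := by
  rcases h with h | rfl
  · exact Or.inl (ltP_of_lt_le h h')
  · assumption

/-- Explicit form of the tails of members of `J` with base `t` and last entry `g`. -/
def Tail (g : Lam lam) (r : List (V lam)) : Prop :=
  r = [] ∨ ∃ p r', r = posEl lam p :: r' ∧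
    (p < g ∨ (p = g ∧ ∃ q r'', r' = negEl lam q :: r''))

theorem tail_iff (g : Lam lam) (r : List (V lam)) :
    Tail g r ↔ ((ltL lam [] r ∨ [] = r) ∧ ltL lam r [posEl lam g]) := by
  constructor
  · rintro (rfl | ⟨p, r', rfl, h | ⟨rfl, q, r'', rfl⟩⟩)
    · exact ⟨Or.inr rfl, ⟨g, rfl⟩⟩
    · refine ⟨Or.inl ⟨p, rfl⟩, Or.inr ?_⟩
      have := posEl_lt.2 h
      exact ⟨this.ne, this⟩
    · exact ⟨Or.inl ⟨p, rfl⟩, Or.inl ⟨rfl, ⟨q, rfl⟩⟩⟩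
  · rintro ⟨h | rfl, h'⟩
    · cases r with
      | nil => exact Or.inl rfl
      | cons b r' =>
        obtain ⟨p, rfl⟩ := h
        refine Or.inr ⟨p, r', rfl, ?_⟩
        rcases h' with ⟨h1, h2⟩ | ⟨_, h2⟩
        · refine Or.inr ⟨posEl_inj.1 h1, ?_⟩
          cases r' with
          | nil => exact h2.elim
          | cons c r'' =>
            obtain ⟨q, rfl⟩ := h2
            exact ⟨q, r'', rfl⟩
        · exact Or.inl (posEl_lt.1 h2)
    · exact Or.inl rfl

theorem interval_iff (g : Lam lam) : ∀ t z : List (V lam),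
    ((ltL lam t z ∨ t = z) ∧ ltL lam z (t ++ [posEl lam g])) ↔ ∃ r, z = t ++ r ∧ Tail g r
  | [], z => by
      simp only [List.nil_append, exists_eq_left']
      exact (tail_iff g z).symm
  | a :: t, [] => by
      simp only [ltL, List.cons_append]
      constructor
      · rintro ⟨h | h, h'⟩
        · exact (not_neg_pos h h').elim
        · cases h
      · rintro ⟨r, h, _⟩
        cases h
  | a :: t, b :: z => by
      have ih := interval_iff g t z
      simp only [ltL, List.cons_append]
      constructor
      · rintro ⟨h, h'⟩
        have hab : a ≤ b := by
          rcases h with (h | h) | h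
          · exact h.1.le
          · exact h.2.le
          · cases h; exact le_rfl
        have hba : b ≤ a := by
          rcases h' with h | h
          · exact h.1.le
          · exact h.2.le
        have e := le_antisymm hab hba
        subst e
        obtain ⟨r, hr, hT⟩ := ih.1 ⟨by simpa using h, by simpa using h'⟩
        exact ⟨r, by rw [hr], hT⟩
      · rintro ⟨r, h, hT⟩
        injection h with h1 h2
        subst h1
        have := ih.2 ⟨r, h2, hT⟩
        simpa using this

theorem mem_Jset {x z : L mu lam} {t : List (V lam)} {g : Lam lam}
    (hx : x.2 = t ++ [posEl lam g]) :
    z ∈ Jset mu lam x ↔ z.1 = x.1 ∧ ∃ r, z.2 = t ++ r ∧ Tail g r := by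
  rw [← interval_iff]
  obtain ⟨a, l⟩ := x
  obtain ⟨b, s⟩ := z
  simp only at hx
  subst hx
  simp only [Jset, leP, ltP, Set.mem_ofPred_eq, List.dropLast_concat, Prod.mk.injEq]
  constructor
  · rintro ⟨h, h'⟩
    have hab : a ≤ b := by
      rcases h with (h | h) | h
      · exact h.le
      · exact h.1.le
      · exact h.1.le
    have hba : b ≤ a := by
      rcases h' with h | h
      · exact h.le
      · exact h.1.le
    have e := le_antisymm hab hba
    subst e
    exact ⟨rfl, by simpa using h, by simpa using h'⟩
  · rintro ⟨rfl, h⟩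
    simpa using h

/-- Shape of a relevant sequence. -/
theorem relevant_shape {S : W.{u} → Set (Lam lam)} {x : L mu lam} (h : Relevant mu lam S x) :
    ∃ (t : List (V lam)) (g : Lam lam), x.2 = t ++ [posEl lam g] ∧
      g.1 < (Cardinal.aleph 1 : Cardinal.{u}).ord ∧ Odd t.length := by
  obtain ⟨h2, he, -, ⟨g, hg, hl⟩, -⟩ := h
  have hne : x.2 ≠ [] := by
    intro h0
    simp [h0] at h2
  refine ⟨x.2.dropLast, g, ?_, hg, ?_⟩
  · have h1 : x.2.getLast hne = posEl lam g := by
      rw [← List.getLast?_eq_getElem?, List.getLast?_eq_some_getLast hne] at hl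
      exact Option.some.inj hl
    rw [← h1, List.dropLast_append_getLast]
  · rw [List.length_dropLast]
    exact Nat.Even.sub_odd (by omega) he odd_one

/-- Descent: how a longer relevant base continues. -/
theorem relevant_cont {S : W.{u} → Set (Lam lam)} {y : L mu lam} (h : Relevant mu lam S y)
    {t r : List (V lam)} {b : V lam} {g : Lam lam} (ht : Odd t.length)
    (hy : y.2 = (t ++ b :: r) ++ [posEl lam g]) (ho : Odd (t ++ b :: r).length) :
    ∃ (p q : Lam lam) (r' : List (V lam)), b = posEl lam p ∧ r = negEl lam q :: r' := by
  obtain ⟨-, -, h3, -, -⟩ := h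
  have e1 : y.2[t.length]? = some b := by
    rw [hy]; simp
  have l1 : t.length < y.2.length := by
    rw [hy]; simp
  obtain ⟨p, hp⟩ := (h3 _ l1).2 ht.add_one
  rw [e1] at hp
  cases r with
  | nil =>
    simp only [List.length_append, List.length_cons, List.length_nil] at ho
    exact absurd ht.add_one (Nat.not_even_iff_odd.2 ho)
  | cons c r' =>
    have e2 : y.2[t.length + 1]? = some c := by
      rw [hy]; simp
    have l2 : t.length + 1 < y.2.length := by
      rw [hy]; simp
    obtain ⟨q, hq⟩ := (h3 _ l2).1 ht.add_one.add_one
    rw [e2] at hq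
    exact ⟨p, q, r', Option.some.inj hp, by rw [Option.some.inj hq]⟩

theorem relevant_head {S : W.{u} → Set (Lam lam)} {y : L mu lam} (h : Relevant mu lam S y)
    {t : List (V lam)} {g : Lam lam} (hy : y.2 = t ++ [posEl lam g]) (ho : Odd t.length) :
    ∃ (q : Lam lam) (r : List (V lam)), t = negEl lam q :: r := by
  obtain ⟨h2, -, h3, -, -⟩ := h
  cases t with
  | nil => simp at ho
  | cons c r =>
    obtain ⟨q, hq⟩ := (h3 0 (by omega)).1 odd_one
    rw [hy] at hq
    simp at hq
    exact ⟨q, r, by rw [hq]⟩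

/-- Two sets are nested or disjoint. -/
def Nested (A B : Set (L mu lam)) : Prop := A ∩ B = ∅ ∨ A ⊆ B ∨ B ⊆ A

theorem Nested.symm {A B : Set (L mu lam)} (h : Nested A B) : Nested B A := by
  rcases h with h | h | h
  · exact Or.inl (by rw [Set.inter_comm]; exact h)
  · exact Or.inr (Or.inr h)
  · exact Or.inr (Or.inl h)

theorem tail_mono {g g' : Lam lam} (h : g ≤ g') {r : List (V lam)} (hr : Tail g r) : Tail g' r := by
  rcases hr with rfl | ⟨p, r', rfl, hp | ⟨rfl, hq⟩⟩
  · exact Or.inl rfl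
  · exact Or.inr ⟨p, r', rfl, Or.inl (hp.trans_le h)⟩
  · rcases h.lt_or_eq with h | rfl
    · exact Or.inr ⟨p, r', rfl, Or.inl h⟩
    · exact Or.inr ⟨p, r', rfl, Or.inr ⟨rfl, hq⟩⟩

theorem nested_JJ_aux {S : W.{u} → Set (Lam lam)} {x y : L mu lam}
    (hy : Relevant mu lam S y) (hxy : x.1 = y.1)
    {t : List (V lam)} {g g' : Lam lam} (ht : Odd t.length) (ex : x.2 = t ++ [posEl lam g])
    {r : List (V lam)} (ey : y.2 = (t ++ r) ++ [posEl lam g']) (ho : Odd (t ++ r).length) :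
    Nested (Jset mu lam x) (Jset mu lam y) := by
  cases r with
  | nil =>
    rw [List.append_nil] at ey
    rcases le_total g g' with h | h
    · right; left
      intro z hz
      rw [mem_Jset ex] at hz
      rw [mem_Jset ey]
      obtain ⟨h1, r, h2, h3⟩ := hz
      exact ⟨h1.trans hxy, r, h2, tail_mono h h3⟩
    · right; right
      intro z hz
      rw [mem_Jset ey] at hz
      rw [mem_Jset ex]
      obtain ⟨h1, r, h2, h3⟩ := hz
      exact ⟨h1.trans hxy.symm, r, h2, tail_mono h h3⟩
  | cons b r =>
    obtain ⟨p, q, r', rfl, rfl⟩ := relevant_cont hy ht ey ho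
    rcases le_or_gt p g with h | h
    · right; right
      intro z hz
      rw [mem_Jset ey] at hz
      rw [mem_Jset ex]
      obtain ⟨h1, s, h2, h3⟩ := hz
      refine ⟨h1.trans hxy.symm, posEl lam p :: negEl lam q :: (r' ++ s), by simp [h2], ?_⟩
      refine Or.inr ⟨p, _, rfl, ?_⟩
      rcases h.lt_or_eq with h | h
      · exact Or.inl h
      · exact Or.inr ⟨h, q, _, rfl⟩
    · left
      rw [Set.eq_empty_iff_forall_notMem]
      rintro z ⟨hz, hz'⟩
      rw [mem_Jset ex] at hz
      rw [mem_Jset ey] at hz'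
      obtain ⟨-, s, h2, h3⟩ := hz
      obtain ⟨-, s', h2', -⟩ := hz'
      rw [h2, List.append_assoc] at h2'
      have h4 := List.append_cancel_left h2'
      subst h4
      rcases h3 with h3 | ⟨p', _, h3, h5⟩
      · simp at h3
      · simp only [List.cons_append, List.cons.injEq, posEl_inj] at h3
        rw [← h3.1] at h5
        rcases h5 with h5 | h5
        · exact lt_asymm h h5
        · exact h.ne' h5.1

theorem nested_JJ {S : W.{u} → Set (Lam lam)} {x y : L mu lam}
    (hx : Relevant mu lam S x) (hy : Relevant mu lam S y) :
    Nested (Jset mu lam x) (Jset mu lam y) := by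
  obtain ⟨t, g, ex, hg, ho⟩ := relevant_shape hx
  obtain ⟨t', g', ey, hg', ho'⟩ := relevant_shape hy
  by_cases hemp : Jset mu lam x ∩ Jset mu lam y = ∅
  · exact Or.inl hemp
  obtain ⟨z, hz, hz'⟩ := Set.nonempty_iff_ne_empty.2 hemp
  rw [mem_Jset ex] at hz
  rw [mem_Jset ey] at hz'
  obtain ⟨h1, s, h2, -⟩ := hz
  obtain ⟨h1', s', h2', -⟩ := hz'
  have hxy := h1.symm.trans h1'
  have p1 : t <+: z.2 := ⟨s, h2.symm⟩
  have p2 : t' <+: z.2 := ⟨s', h2'.symm⟩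
  rcases List.prefix_or_prefix_of_prefix p1 p2 with ⟨r, rfl⟩ | ⟨r, rfl⟩
  · exact nested_JJ_aux hy hxy ho ex ey ho'
  · exact (nested_JJ_aux hx hxy.symm ho' ey ex ho).symm

theorem nested_LJ {S : W.{u} → Set (Lam lam)} (a : M mu) {y : L mu lam}
    (hy : Relevant mu lam S y) :
    Nested {z | ltP mu lam z (a, ([] : List (V lam)))} (Jset mu lam y) := by
  obtain ⟨t, g, ey, hg, ho⟩ := relevant_shape hy
  obtain ⟨q, r, rfl⟩ := relevant_head hy ey ho
  rcases le_or_gt y.1 a with h | h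
  · right; right
    intro z hz
    rw [mem_Jset ey] at hz
    obtain ⟨h1, s, h2, -⟩ := hz
    rcases h.lt_or_eq with h | h
    · exact Or.inl (by rw [h1]; exact h)
    · refine Or.inr ⟨h1.trans h, ?_⟩
      rw [h2]
      exact ⟨q, rfl⟩
  · left
    rw [Set.eq_empty_iff_forall_notMem]
    rintro z ⟨hz, hz'⟩
    rw [mem_Jset ey] at hz'
    rcases hz with hz | hz
    · exact lt_asymm h (hz'.1 ▸ hz)
    · exact h.ne (hz.1.symm.trans hz'.1)

theorem nested_LL (a b : M mu) :
    Nested {z | ltP mu lam z (a, ([] : List (V lam)))}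
      {z | ltP mu lam z (b, ([] : List (V lam)))} := by
  rcases lt_trichotomy a b with h | rfl | h
  · exact Or.inr (Or.inl fun z hz => ltP_trans hz (Or.inl h))
  · exact Or.inr (Or.inl subset_rfl)
  · exact Or.inr (Or.inr fun z hz => ltP_trans hz (Or.inl h))

theorem nested_singleton (z : L mu lam) (B : Set (L mu lam)) : Nested {z} B := by
  by_cases h : z ∈ B
  · exact Or.inr (Or.inl (Set.singleton_subset_iff.2 h))
  · exact Or.inl (Set.singleton_inter_eq_empty.2 h)

theorem nested_basic {S : W.{u} → Set (Lam lam)} {x y : L mu lam} {B C : Set (L mu lam)}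
    (hB : IsBasic mu lam S x B) (hC : IsBasic mu lam S y C) : Nested B C := by
  rcases hB with ⟨a, -, rfl⟩ | ⟨b, hb, -, rfl⟩ | rfl | ⟨z, -, rfl⟩
  · rcases hC with ⟨a', -, rfl⟩ | ⟨b', hb', -, rfl⟩ | rfl | ⟨z', -, rfl⟩
    · exact nested_LL a a'
    · exact nested_LJ a hb'
    · exact Or.inl (Set.inter_empty _)
    · exact (nested_singleton z' _).symm
  · rcases hC with ⟨a', -, rfl⟩ | ⟨b', hb', -, rfl⟩ | rfl | ⟨z', -, rfl⟩
    · exact (nested_LJ a' hb).symm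
    · exact nested_JJ hb hb'
    · exact Or.inl (Set.inter_empty _)
    · exact (nested_singleton z' _).symm
  · exact Or.inl (Set.empty_inter _)
  · exact nested_singleton z _

theorem basic_empty (S : W.{u} → Set (Lam lam)) (x : L mu lam) : IsBasic mu lam S x ∅ :=
  Or.inr (Or.inr (Or.inl rfl))

theorem basic_inter {S : W.{u} → Set (Lam lam)} {x : L mu lam} {B C : Set (L mu lam)}
    (hB : IsBasic mu lam S x B) (hC : IsBasic mu lam S x C) : IsBasic mu lam S x (B ∩ C) := by
  rcases nested_basic hB hC with h | h | h
  · rw [h]; exact basic_empty S x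
  · rwa [Set.inter_eq_left.2 h]
  · rwa [Set.inter_eq_right.2 h]

theorem basic_mono {S : W.{u} → Set (Lam lam)} {x y : L mu lam} (h : leP mu lam x y)
    {B : Set (L mu lam)} (hB : IsBasic mu lam S x B) : IsBasic mu lam S y B := by
  rcases hB with ⟨a, ha, rfl⟩ | ⟨b, hb, hb', rfl⟩ | rfl | ⟨z, hz, rfl⟩
  · exact Or.inl ⟨a, leP_trans ha h, rfl⟩
  · exact Or.inr (Or.inl ⟨b, hb, leP_trans hb' h, rfl⟩)
  · exact basic_empty S y
  · exact Or.inr (Or.inr (Or.inr ⟨z, ltP_of_lt_le hz h, rfl⟩))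

theorem basic_sub {S : W.{u} → Set (Lam lam)} {x : L mu lam}
    {B : Set (L mu lam)} (hB : IsBasic mu lam S x B) {y : L mu lam} (hy : y ∈ B) :
    ltP mu lam y x := by
  rcases hB with ⟨a, ha, rfl⟩ | ⟨b, hb, hb', rfl⟩ | rfl | ⟨z, hz, rfl⟩
  · exact ltP_of_lt_le hy ha
  · exact ltP_of_lt_le hy.2 hb'
  · exact hy.elim
  · rw [Set.mem_singleton_iff.1 hy]; exact hz

theorem Ix_of_basic {S : W.{u} → Set (Lam lam)} {x : L mu lam}
    {B : Set (L mu lam)} (hB : IsBasic mu lam S x B) : B ∈ Ix mu lam S x :=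
  ⟨{B}, by simpa using hB, by simp⟩

theorem Ix_union {S : W.{u} → Set (Lam lam)} {x : L mu lam} {B C : Set (L mu lam)}
    (hB : B ∈ Ix mu lam S x) (hC : C ∈ Ix mu lam S x) : B ∪ C ∈ Ix mu lam S x := by
  classical
  obtain ⟨s, hs, rfl⟩ := hB
  obtain ⟨t, ht, rfl⟩ := hC
  refine ⟨s ∪ t, ?_, ?_⟩
  · intro D hD
    rcases Finset.mem_union.1 hD with h | h
    · exact hs D h
    · exact ht D h
  · rw [Finset.coe_union, Set.sUnion_union]

theorem Ix_inter {S : W.{u} → Set (Lam lam)} {x : L mu lam} {B C : Set (L mu lam)}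
    (hB : B ∈ Ix mu lam S x) (hC : C ∈ Ix mu lam S x) : B ∩ C ∈ Ix mu lam S x := by
  classical
  obtain ⟨s, hs, rfl⟩ := hB
  obtain ⟨t, ht, rfl⟩ := hC
  refine ⟨(s ×ˢ t).image fun p => p.1 ∩ p.2, ?_, ?_⟩
  · intro D hD
    obtain ⟨p, hp, rfl⟩ := Finset.mem_image.1 hD
    rw [Finset.mem_product] at hp
    exact basic_inter (hs _ hp.1) (ht _ hp.2)
  · ext z
    simp only [Set.mem_inter_iff, Set.mem_sUnion, Finset.mem_coe, Finset.mem_image,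
      Finset.mem_product]
    constructor
    · rintro ⟨⟨A, hA, hz⟩, D, hD, hz'⟩
      exact ⟨_, ⟨(A, D), ⟨hA, hD⟩, rfl⟩, hz, hz'⟩
    · rintro ⟨_, ⟨p, hp, rfl⟩, hz, hz'⟩
      exact ⟨⟨_, hp.1, hz⟩, _, hp.2, hz'⟩

theorem Ix_mono {S : W.{u} → Set (Lam lam)} {x y : L mu lam} (h : leP mu lam x y) :
    Ix mu lam S x ⊆ Ix mu lam S y := by
  rintro _ ⟨s, hs, rfl⟩
  exact ⟨s, fun C hC => basic_mono h (hs C hC), rfl⟩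

/-- The union of all the `ℐ_x`. -/
def Fam (S : W.{u} → Set (Lam lam)) : Set (Set (L mu lam)) := {B | ∃ x, B ∈ Ix mu lam S x}

theorem Fam_inter {S : W.{u} → Set (Lam lam)} {B C : Set (L mu lam)}
    (hB : B ∈ Fam S) (hC : C ∈ Fam S) : B ∩ C ∈ Fam S := by
  obtain ⟨x, hx⟩ := hB
  obtain ⟨y, hy⟩ := hC
  rcases ltP_tri x y with h | rfl | h
  · exact ⟨y, Ix_inter (Ix_mono (Or.inl h) hx) hy⟩
  · exact ⟨x, Ix_inter hx hy⟩
  · exact ⟨x, Ix_inter hx (Ix_mono (Or.inl h) hy)⟩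

/-- Strict inclusion with smaller set in the family. -/
def R (S : W.{u} → Set (Lam lam)) (X Y : Set (L mu lam)) : Prop := X ∈ Fam S ∧ X ⊂ Y

theorem acc_union {S : W.{u} → Set (Lam lam)} {X : Set (L mu lam)} (hX : Acc (R S) X) :
    ∀ {Y : Set (L mu lam)}, Acc (R S) Y → X ∈ Fam S → Y ∈ Fam S → Acc (R S) (X ∪ Y) := by
  induction hX with
  | intro X hX ihX =>
    intro Y hY
    induction hY with
    | intro Y hY ihY =>
      intro fX fY
      refine Acc.intro _ ?_
      rintro Z ⟨fZ, hZ⟩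
      have e : Z = (Z ∩ X) ∪ (Z ∩ Y) := by
        rw [← Set.inter_union_distrib_left, Set.inter_eq_left.2 hZ.subset]
      rw [e]
      have f1 := Fam_inter fZ fX
      have f2 := Fam_inter fZ fY
      by_cases h1 : Z ∩ X = X
      · have h2 : Z ∩ Y ≠ Y := by
          intro h2
          rw [h1, h2] at e
          exact hZ.ne e
        rw [h1]
        exact ihY _ ⟨f2, Set.inter_subset_right.ssubset_of_ne h2⟩ fX f2
      · have r1 : R S (Z ∩ X) X := ⟨f1, Set.inter_subset_right.ssubset_of_ne h1⟩
        have a2 : Acc (R S) (Z ∩ Y) := by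
          by_cases h2 : Z ∩ Y = Y
          · rw [h2]; exact Acc.intro _ hY
          · exact hY _ ⟨f2, Set.inter_subset_right.ssubset_of_ne h2⟩
        exact ihX _ r1 a2 f1 f2

theorem acc_sUnion {S : W.{u} → Set (Lam lam)} {x : L mu lam} (s : Finset (Set (L mu lam)))
    (hs : ∀ C ∈ s, IsBasic mu lam S x C) (ha : ∀ C ∈ s, Acc (R S) C) :
    Acc (R S) (⋃₀ (s : Set (Set (L mu lam)))) := by
  classical
  induction s using Finset.induction_on with
  | empty =>
    refine Acc.intro _ ?_
    rintro Z ⟨_, hZ⟩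
    rw [Finset.coe_empty, Set.sUnion_empty] at hZ
    exact absurd (Set.empty_subset Z) hZ.not_subset
  | insert C s hC ih =>
    rw [Finset.coe_insert, Set.sUnion_insert]
    have hs' : ∀ D ∈ s, IsBasic mu lam S x D := fun D hD => hs D (Finset.mem_insert_of_mem hD)
    exact acc_union (ha C (Finset.mem_insert_self _ _))
      (ih hs' fun D hD => ha D (Finset.mem_insert_of_mem hD))
      ⟨x, Ix_of_basic (hs C (Finset.mem_insert_self _ _))⟩ ⟨x, s, hs', rfl⟩

theorem acc_of_basic {S : W.{u} → Set (Lam lam)} {B : Set (L mu lam)}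
    (h : ∀ x C, IsBasic mu lam S x C → C ⊂ B → Acc (R S) C) : Acc (R S) B := by
  refine Acc.intro _ ?_
  rintro _ ⟨⟨x, s, hs, rfl⟩, hZ⟩
  exact acc_sUnion s hs fun C hC =>
    h x C (hs C hC) ((Set.subset_sUnion_of_mem (Finset.mem_coe.2 hC)).trans_ssubset hZ)

theorem acc_empty (S : W.{u} → Set (Lam lam)) : Acc (R S) (∅ : Set (L mu lam)) :=
  Acc.intro _ fun Z hZ => absurd (Set.empty_subset Z) hZ.2.not_subset

theorem acc_singleton (S : W.{u} → Set (Lam lam)) (z : L mu lam) :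
    Acc (R S) ({z} : Set (L mu lam)) :=
  Acc.intro _ fun Z hZ => by
    rw [Set.ssubset_singleton_iff.1 hZ.2]; exact acc_empty S

theorem J_base_mem {x : L mu lam} {t : List (V lam)} {g : Lam lam}
    (hx : x.2 = t ++ [posEl lam g]) : (x.1, t) ∈ Jset mu lam x :=
  (mem_Jset hx).2 ⟨rfl, [], by simp, Or.inl rfl⟩

theorem L_not_ssub_J {S : W.{u} → Set (Lam lam)} (a : M mu) {y : L mu lam}
    (hy : Relevant mu lam S y) (hlam : Cardinal.aleph0 ≤ lam)
    (h : {z | ltP mu lam z (a, ([] : List (V lam)))} ⊆ Jset mu lam y) : False := by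
  obtain ⟨t, g, ey, hg, ho⟩ := relevant_shape hy
  have h1 := fun (d : Lam lam) => (mem_Jset ey).1 (h (show (a, [negEl lam d]) ∈ _ from
    Or.inr ⟨rfl, ⟨d, rfl⟩⟩))
  obtain ⟨q, r, rfl⟩ := relevant_head hy ey ho
  obtain ⟨-, s, hs, -⟩ := h1 q
  have hlim : Order.IsSuccLimit lam.ord := Cardinal.isSuccLimit_ord hlam
  obtain ⟨-, s, hs, -⟩ := h1 ⟨Order.succ q.1, hlim.succ_lt q.2⟩
  simp only [List.cons_append, List.cons.injEq, negEl_inj] at hs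
  have := congrArg Subtype.val hs.1
  exact (Order.lt_succ q.1).ne' this

theorem acc_J {S : W.{u} → Set (Lam lam)} (hlam : Cardinal.aleph0 ≤ lam)
    (hdisj : ∀ α β : W.{u}, α ≠ β → S α ∩ S β = ∅) (α : W.{u}) :
    ∀ (g : Lam lam) (x : L mu lam) (t : List (V lam)) (d : Lam lam), Relevant mu lam S x →
      x.2 = t ++ [negEl lam d] ++ [posEl lam g] → d ∈ S α → Acc (R S) (Jset mu lam x) := by
  induction α using WellFoundedLT.induction with
  | ind α ihα =>
  intro g
  induction g using WellFoundedLT.induction with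
  | ind g ihg =>
  intro x t d hx ex hd
  refine acc_of_basic ?_
  rintro v C (⟨a, -, rfl⟩ | ⟨y, hy, -, rfl⟩ | rfl | ⟨z, -, rfl⟩) hC
  · exact (L_not_ssub_J a hx hlam hC.subset).elim
  · obtain ⟨t0, g0, ex0, hg0, ho⟩ := relevant_shape hx
    have hh : t0 = t ++ [negEl lam d] ∧ g0 = g := by
      rw [ex0] at ex
      have := List.append_inj' ex rfl
      refine ⟨this.1, ?_⟩
      simpa [posEl_inj] using this.2
    obtain ⟨rfl, rfl⟩ := hh
    obtain ⟨t', g', ey, hg', ho'⟩ := relevant_shape hy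
    have hm := (mem_Jset ex).1 (hC.subset (J_base_mem ey))
    obtain ⟨hxy, r, hr, hT⟩ := hm
    simp only at hxy hr
    subst hr
    rcases hT with rfl | ⟨p, r', rfl, hp⟩
    · rw [List.append_nil] at ey
      refine ihg g' ?_ y t d hy ey hd
      by_contra hlt
      refine hC.not_subset ?_
      intro z hz
      rw [mem_Jset ex] at hz
      rw [mem_Jset ey]
      obtain ⟨h1, s, h2, h3⟩ := hz
      exact ⟨h1.trans hxy.symm, s, h2, tail_mono (not_lt.1 hlt) h3⟩
    · have hpg : p ≤ g0 := by
        rcases hp with hp | hp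
        · exact hp.le
        · exact hp.1.le
      have hpw : p.1 < (Cardinal.aleph 1 : Cardinal.{u}).ord := lt_of_le_of_lt hpg hg0
      obtain ⟨y2, ye, y3, -, y5⟩ := hy
      have hyl : y.2.length = t.length + 1 + (r'.length + 1) + 1 := by
        rw [ey]; simp; omega
      obtain ⟨β', β, hβ, ⟨δ, hδ, hδS⟩, δ', hδ', hδS'⟩ :=
        y5 (t.length + 2) y.2.length (by omega) (by omega) le_rfl
          (by have := ho.add_one; rw [List.length_append] at this; exact this) ye p g' (by rw [ey]; simp)
          (by rw [← List.getLast?_eq_getElem?, ey, List.getLast?_concat]) hpw hg'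
      have e1 : δ = d := by
        rw [ey] at hδ
        simpa [negEl_inj, eq_comm] using hδ
      subst e1
      have e2 : β' = α := by
        by_contra hne
        have := hdisj _ _ hne
        exact Set.notMem_empty δ (this ▸ ⟨hδS, hd⟩)
      subst e2
      obtain ⟨t2, c, ht2⟩ : ∃ t2 c, t ++ [negEl lam δ] ++ posEl lam p :: r' = t2 ++ [c] := by
        refine ⟨_, _, (List.dropLast_append_getLast (l := t ++ [negEl lam δ] ++ posEl lam p :: r')
          (by simp)).symm⟩
      rw [ht2] at ey
      have hc : c = negEl lam δ' := by
        rw [ey] at hδ'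
        simpa using hδ'
      subst hc
      exact ihα β hβ g' y t2 δ' ⟨y2, ye, y3, ⟨g', hg', by rw [ey]; simp⟩, y5⟩ ey hδS'
  · exact acc_empty S
  · exact acc_singleton S z

theorem acc_J' {S : W.{u} → Set (Lam lam)} (hlam : Cardinal.aleph0 ≤ lam)
    (hdisj : ∀ α β : W.{u}, α ≠ β → S α ∩ S β = ∅)
    (hcover : ∀ γ : Lam lam, ∃ α : W.{u}, γ ∈ S α) {x : L mu lam} (hx : Relevant mu lam S x) :
    Acc (R S) (Jset mu lam x) := by
  obtain ⟨t, g, ex, hg, ho⟩ := relevant_shape hx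
  have hne : t ≠ [] := by
    rintro rfl
    simp at ho
  obtain ⟨t2, c, rfl⟩ : ∃ t2 c, t = t2 ++ [c] :=
    ⟨_, _, (List.dropLast_append_getLast hne).symm⟩
  obtain ⟨d, hd⟩ := (hx.2.2.1 t2.length (by rw [ex]; simp)).1 (by simpa using ho)
  have hc : c = negEl lam d := by
    rw [ex] at hd
    simpa using hd
  subst hc
  obtain ⟨α, hα⟩ := hcover d
  exact acc_J hlam hdisj α g x t2 d hx ex hα

theorem acc_L {S : W.{u} → Set (Lam lam)} (hlam : Cardinal.aleph0 ≤ lam)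
    (hdisj : ∀ α β : W.{u}, α ≠ β → S α ∩ S β = ∅)
    (hcover : ∀ γ : Lam lam, ∃ α : W.{u}, γ ∈ S α) (a : M mu) :
    Acc (R S) {z | ltP mu lam z (a, ([] : List (V lam)))} := by
  induction a using WellFoundedLT.induction with
  | ind a ih =>
  refine acc_of_basic ?_
  rintro v C (⟨b, -, rfl⟩ | ⟨y, hy, -, rfl⟩ | rfl | ⟨z, -, rfl⟩) hC
  · refine ih b ?_
    by_contra h
    refine hC.not_subset ?_
    rcases (not_lt.1 h).lt_or_eq with h | rfl
    · exact fun z hz => ltP_trans hz (Or.inl h)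
    · exact subset_rfl
  · exact acc_J' hlam hdisj hcover hy
  · exact acc_empty S
  · exact acc_singleton S z

theorem acc_all {S : W.{u} → Set (Lam lam)} (hlam : Cardinal.aleph0 ≤ lam)
    (hdisj : ∀ α β : W.{u}, α ≠ β → S α ∩ S β = ∅)
    (hcover : ∀ γ : Lam lam, ∃ α : W.{u}, γ ∈ S α) (B : Set (L mu lam)) :
    Acc (R S) B := by
  refine acc_of_basic ?_
  rintro v C (⟨b, -, rfl⟩ | ⟨y, hy, -, rfl⟩ | rfl | ⟨z, -, rfl⟩) hC
  · exact acc_L hlam hdisj hcover b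
  · exact acc_J' hlam hdisj hcover hy
  · exact acc_empty S
  · exact acc_singleton S z

end helpers

/-- `(L(μ,λ), (ℐ_x)_{x ∈ L})` is a template. -/
theorem stmt_15 (hmu : Cardinal.aleph0 ≤ mu) (hlam : Cardinal.aleph0 ≤ lam)
    (S : W.{u} → Set (Lam lam))
    (hdisj : ∀ α β : W.{u}, α ≠ β → S α ∩ S β = ∅)
    (hcover : ∀ γ : Lam lam, ∃ α : W.{u}, γ ∈ S α)
    (hcoinit : ∀ α : W.{u}, ∀ β : Lam lam, ∃ γ ∈ S α, β ≤ γ) :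
    -- the relation is a (strict) linear order on L
    IsStrictTotalOrder (L mu lam) (ltP mu lam) ∧
    -- each ℐ_x is a family of subsets of L_x
    (∀ x : L mu lam, ∀ B ∈ Ix mu lam S x, ∀ y ∈ B, ltP mu lam y x) ∧
    -- containing ∅ and all singletons of elements of L_x
    (∀ x : L mu lam, (∅ : Set (L mu lam)) ∈ Ix mu lam S x) ∧
    (∀ x y : L mu lam, ltP mu lam y x → ({y} : Set (L mu lam)) ∈ Ix mu lam S x) ∧
    -- closed under finite unions and finite intersections
    (∀ x : L mu lam, ∀ B ∈ Ix mu lam S x, ∀ C ∈ Ix mu lam S x,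
      B ∪ C ∈ Ix mu lam S x ∧ B ∩ C ∈ Ix mu lam S x) ∧
    -- ℐ_x ⊆ ℐ_y whenever x < y
    (∀ x y : L mu lam, ltP mu lam x y → Ix mu lam S x ⊆ Ix mu lam S y) ∧
    -- ℐ = ⋃_x ℐ_x ∪ {L} is well-founded with respect to strict inclusion
    WellFounded (fun X Y : ((⋃ x, Ix mu lam S x) ∪ {Set.univ} : Set (Set (L mu lam))) =>
      (X : Set (L mu lam)) ⊂ (Y : Set (L mu lam))) := by
  refine ⟨?_, ?_, ?_, ?_, ?_, ?_, ?_⟩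
  · exact { irrefl := ltP_irrefl
            trans := fun _ _ _ => ltP_trans
            trichotomous := fun a b h h' => by
              rcases ltP_tri a b with k | k | k
              · exact (h k).elim
              · exact k
              · exact (h' k).elim }
  · rintro x _ ⟨s, hs, rfl⟩ y ⟨C, hC, hy⟩
    exact basic_sub (hs C hC) hy
  · exact fun x => Ix_of_basic (basic_empty S x)
  · exact fun x y h => Ix_of_basic (Or.inr (Or.inr (Or.inr ⟨y, h, rfl⟩)))
  · exact fun x B hB C hC => ⟨Ix_union hB hC, Ix_inter hB hC⟩
  · exact fun x y h => Ix_mono (Or.inl h)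
  · have hwf : WellFounded (R (mu := mu) S) := ⟨acc_all hlam hdisj hcover⟩
    refine Subrelation.wf ?_ (InvImage.wf Subtype.val hwf)
    rintro ⟨X, hX⟩ ⟨Y, hY⟩ h
    refine ⟨?_, h⟩
    rcases hX with hX | rfl
    · exact Set.mem_iUnion.1 hX
    · exact absurd h (fun h => h.not_subset (Set.subset_univ _))

end Stmt15
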